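/- arXiv:2101.09107 — 2 statements merged into one kernel-verified Lean document; each statement's English description precedes it below -/
import Mathlib

section
/- With p_k(l_k|H_{k−1}) and p_k(a_{l_k}|H_{k−1}, x_{l_k}) defined by Definitions 4–5 from the protocol states (assigning arbitrary values where a denominator vanishes), for every choice of settings x⃗ and outcomes a⃗ the causal-model expression Σ_{l_1∉ℒ_0} ⋯ Σ_{l_N∉ℒ_{N−1}} ∏_{k=1}^N p_k(l_k|H_{k−1}) p_k(a_{l_k}|H_{k−1}, x_{l_k}) equals p^quantum(a⃗|x⃗) = ‖(|a⃗⟩⟨a⃗|_r ⊗ I) 𝒰|0⟩‖². -/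
noncomputable section

/-!
Shared framework: quantum protocols with a quantum control of causal order,
following Purves & Short, "Quantum theory cannot violate a causal inequality".

The total Hilbert space `H_s ⊗ H_c ⊗ (⊗ᵢ H_{rᵢ}) ⊗ (⊗ᵢ H_{fᵢ})` is modelled
concretely as `ℓ²` of the finite basis-index set
`Idx = S × Fin (N+1) × (Π i, A i) × (Π i, Fin (T+1))`
(system basis, control basis |0⟩,…,|N⟩, result-register bases, flag bases),
vectors being functions `Idx → ℂ`, operators being matrices.
-/

namespace CIQ

variable {N T : ℕ} {S : Type} [Fintype S] [DecidableEq S]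
variable {A : Fin N → Type} [∀ i, Fintype (A i)] [∀ i, DecidableEq (A i)]
variable {X : Fin N → Type} [∀ i, Fintype (X i)] [∀ i, DecidableEq (X i)]

/-- Basis index set of the total Hilbert space: system × control × results × flags. -/
abbrev Idx (N T : ℕ) (S : Type) (A : Fin N → Type) : Type :=
  S × Fin (N + 1) × ((i : Fin N) → A i) × ((i : Fin N) → Fin (T + 1))

/-- A history: an ordered list of triples (lab, outcome, setting). -/
abbrev Hist (N : ℕ) (A X : Fin N → Type) : Type := List ((l : Fin N) × (A l × X l))

/-- The labs occurring in a history are pairwise distinct. -/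
def labsDistinct (H : Hist N A X) : Prop := (H.map Sigma.fst).Nodup

/-- Squared ℓ²-norm ‖v‖². -/
def nsq (v : Idx N T S A → ℂ) : ℝ := ∑ p, Complex.normSq (v p)

/-- The ℓ² inner product ⟨v|w⟩ (conjugate-linear in the first argument). -/
def hinner (v w : Idx N T S A → ℂ) : ℂ := ∑ p, (starRingEnd ℂ) (v p) * w p

/-- The data of a quantum protocol: a distinguished initial system basis state `s0`,
initial result-register states `r0`, measurement unitaries `Vm l x` on `H_s ⊗ H_{r_l}`
for each lab and setting, and inter-step unitaries `U t` on `H_s ⊗ H_c` (for `1 ≤ t ≤ T`). -/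
structure Protocol (N T : ℕ) (S : Type) (A X : Fin N → Type) where
  s0 : S
  r0 : ∀ i, A i
  Vm : (l : Fin N) → X l → Matrix (S × A l) (S × A l) ℂ
  U : ℕ → Matrix (S × Fin (N + 1)) (S × Fin (N + 1)) ℂ

/-- Extension of an operator on `H_s ⊗ H_c` by the identity on results and flags. -/
def extSC (M : Matrix (S × Fin (N + 1)) (S × Fin (N + 1)) ℂ) :
    Matrix (Idx N T S A) (Idx N T S A) ℂ := fun p q =>
  if p.2.2 = q.2.2 then M (p.1, p.2.1) (q.1, q.2.1) else 0

namespace Protocol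

variable (P : Protocol N T S A X) (x : ∀ l, X l)

/-- Each measurement unitary is indeed unitary. -/
def unitaryVm : Prop := ∀ (l : Fin N) (xv : X l), P.Vm l xv ∈ Matrix.unitaryGroup (S × A l) ℂ

/-- Each inter-step unitary `U t`, `1 ≤ t ≤ T`, is indeed unitary. -/
def unitaryU : Prop :=
  ∀ t : ℕ, 1 ≤ t → t ≤ T → P.U t ∈ Matrix.unitaryGroup (S × Fin (N + 1)) ℂ

/-- The initial state |0⟩ = |0⟩_s |0⟩_c |0⟩_r^N |0⟩_f^N. -/
def ket0 : Idx N T S A → ℂ :=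
  fun p => if p = (P.s0, 0, P.r0, fun _ => 0) then 1 else 0

/-- The lab-activation unitary
`V = |0⟩⟨0|_c ⊗ I + Σ_{l=1}^N |l⟩⟨l|_c ⊗ V_{s,r_l}(x_l) ⊗ Γ_{f_l} ⊗ I`,
where `Γ` is the cyclic shift raising the flag. -/
def Vmat : Matrix (Idx N T S A) (Idx N T S A) ℂ := fun p q =>
  if h : p.2.1 = (0 : Fin (N + 1)) then (if q = p then 1 else 0)
  else
    if q.2.1 = p.2.1 ∧ (∀ i, i ≠ p.2.1.pred h → q.2.2.1 i = p.2.2.1 i)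
        ∧ (∀ i, i ≠ p.2.1.pred h → q.2.2.2 i = p.2.2.2 i)
        ∧ q.2.2.2 (p.2.1.pred h) + 1 = p.2.2.2 (p.2.1.pred h) then
      P.Vm (p.2.1.pred h) (x (p.2.1.pred h))
        (p.1, p.2.2.1 (p.2.1.pred h)) (q.1, q.2.2.1 (p.2.1.pred h))
    else 0

/-- `chain t = V U_t V U_{t-1} ⋯ V U_1`. -/
def chain : ℕ → Matrix (Idx N T S A) (Idx N T S A) ℂ
  | 0 => 1
  | t + 1 => P.Vmat x * (extSC (P.U (t + 1)) * chain t)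

/-- `pre t = U_t V U_{t-1} ⋯ V U_1` (the evolution just before the `t`-th activation). -/
def pre (t : ℕ) : Matrix (Idx N T S A) (Idx N T S A) ℂ :=
  extSC (P.U t) * P.chain x (t - 1)

/-- The total unitary `𝒰 = V U_T V U_{T-1} ⋯ V U_1`. -/
def Uop : Matrix (Idx N T S A) (Idx N T S A) ℂ := P.chain x T

/-- `tailPhi k = V U_T V U_{T-1} ⋯ U_{T-k+1}` (evolution to the end of the protocol,
starting just after the `(T-k)`-th activation); `k` counts remaining time steps. -/
def tailPhi : ℕ → Matrix (Idx N T S A) (Idx N T S A) ℂ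
  | 0 => 1
  | k + 1 => tailPhi k * (P.Vmat x * extSC (P.U (T - k)))

end Protocol

/-- The condition imposed by the projector `π^H_{rf}`: result registers of labs in the
history `H` show the recorded outcomes and their flags are raised (to `1`), while the
flags of all other labs read `0`. -/
def histSat (H : Hist N A X) (rr : ∀ i, A i) (ff : (i : Fin N) → Fin (T + 1)) : Prop :=
  (∀ e ∈ H, rr e.1 = e.2.1 ∧ ff e.1 = 1) ∧ (∀ i : Fin N, (∀ e ∈ H, e.1 ≠ i) → ff i = 0)

instance (H : Hist N A X) (rr : ∀ i, A i) (ff : (i : Fin N) → Fin (T + 1)) :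
    Decidable (histSat H rr ff) := by
  unfold histSat; infer_instance

namespace Protocol

variable (P : Protocol N T S A X) (x : ∀ l, X l)

/-- `|ψ_{(l,t,H)}⟩ = (|l⟩⟨l|_c ⊗ π^H_{rf} ⊗ I_s) U_t V U_{t-1} ⋯ V U_1 |0⟩`,
where the control value `l ∈ {0,1,…,N}`. -/
def psi (l : Fin (N + 1)) (t : ℕ) (H : Hist N A X) : Idx N T S A → ℂ := fun p =>
  if p.2.1 = l ∧ histSat H p.2.2.1 p.2.2.2 then (P.pre x t).mulVec (P.ket0) p else 0

/-- `|ψ̄_{(l,t,H)}⟩ = V U_T V U_{T-1} ⋯ U_{t+1} V |ψ_{(l,t,H)}⟩`. -/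
def psibar (l : Fin (N + 1)) (t : ℕ) (H : Hist N A X) : Idx N T S A → ℂ :=
  (P.tailPhi x (T - t) * P.Vmat x).mulVec (P.psi x l t H)

/-- The just-measured state with previous history `H`:
`(|a⟩⟨a|_{r_l} ⊗ I) V |ψ_{(l,t,H)}⟩` (control value `l` among `1,…,N`). -/
def phiOf (l : Fin N) (a : A l) (t : ℕ) (H : Hist N A X) : Idx N T S A → ℂ := fun p =>
  if p.2.2.1 l = a then (P.Vmat x).mulVec (P.psi x l.succ t H) p else 0

/-- `|φ_{(l,t,H)}⟩` for a lab `l` whose triple `(l, a, x_l)` occurs in the history `H`: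
`(|a⟩⟨a|_{r_l} ⊗ I) V |ψ_{(l,t,H∖(l,a,x_l))}⟩`. -/
def phiFull (l : Fin N) (a : A l) (t : ℕ) (H : Hist N A X) : Idx N T S A → ℂ :=
  P.phiOf x l a t (H.filter fun e => decide (e.1 ≠ l))

/-- `|φ̄_{(l,t,H)}⟩ = V U_T V ⋯ U_{t+1} |φ_{(l,t,H)}⟩`. -/
def phibar (l : Fin N) (a : A l) (t : ℕ) (H : Hist N A X) : Idx N T S A → ℂ :=
  (P.tailPhi x (T - t)).mulVec (P.phiFull x l a t H)

/-- `|φ_{(0,t,H)}⟩ = V |ψ_{(0,t,H)}⟩`. -/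
def phi0 (t : ℕ) (H : Hist N A X) : Idx N T S A → ℂ :=
  (P.Vmat x).mulVec (P.psi x 0 t H)

/-- `|φ̄_{(0,t,H)}⟩ = V U_T V ⋯ U_{t+1} |φ_{(0,t,H)}⟩`. -/
def phibar0 (t : ℕ) (H : Hist N A X) : Idx N T S A → ℂ :=
  (P.tailPhi x (T - t)).mulVec (P.phi0 x t H)

/-- `Σ_{t=1}^T ‖ψ_{(l,t,H)}‖²` (numerator of Definition 4). -/
def numPsi (H : Hist N A X) (l : Fin N) : ℝ :=
  ∑ t ∈ Finset.Icc 1 T, nsq (P.psi x l.succ t H)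

/-- `Σ_{l'∉ℒ} Σ_{t=1}^T ‖ψ_{(l',t,H)}‖²` (denominator of Definition 4). -/
def denPsi (H : Hist N A X) : ℝ :=
  ∑ l ∈ Finset.univ.filter (fun l : Fin N => ∀ e ∈ H, e.1 ≠ l), P.numPsi x H l

/-- Definition 4: `p_k(l_k|H_{k-1})`, the probability for lab `l` to act next. -/
def pNext (H : Hist N A X) (l : Fin N) : ℝ := P.numPsi x H l / P.denPsi x H

/-- `Σ_{t=1}^T ‖φ_{(l,t,(H,(l,a,x_l)))}‖²` (numerator of Definition 5). -/
def numPhi (H : Hist N A X) (l : Fin N) (a : A l) : ℝ :=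
  ∑ t ∈ Finset.Icc 1 T, nsq (P.phiOf x l a t H)

/-- Definition 5: `p_k(a|H_{k-1},x_l)`, the probability for lab `l`, acting next after
history `H` with its setting `x l`, to obtain outcome `a`. -/
def pOut (H : Hist N A X) (l : Fin N) (a : A l) : ℝ :=
  P.numPhi x H l a / ∑ a' : A l, P.numPhi x H l a'

/-- The quantum outcome distribution
`p^quantum(a⃗|x⃗) = ‖(|a⃗⟩⟨a⃗|_r ⊗ I) 𝒰 |0⟩‖²`. -/
def pQ (a : ∀ i, A i) : ℝ :=
  nsq (fun p => if p.2.2.1 = a then (P.Uop x).mulVec P.ket0 p else 0)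

/-- The flag constraint: at the end of the protocol every flag reads `1`
(each party has interacted with the system exactly once). -/
def flagOK : Prop :=
  ∀ p : Idx N T S A, (P.Uop x).mulVec P.ket0 p ≠ 0 → ∀ i, p.2.2.2 i = 1

end Protocol

/-- The causal-model expression of Definition 1, written recursively:
`causalSum q o x a k H` sums over the next `k` parties to act (those not in `H`),
multiplying the 'who is next?' probabilities `q` and the 'what did they see?'
probabilities `o`, with the history extended accordingly.  The full expression
of Definition 1 is `causalSum q o x a N []`. -/
def causalSum (q : Hist N A X → Fin N → ℝ)
    (o : Hist N A X → (l : Fin N) → X l → A l → ℝ)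
    (x : ∀ i, X i) (a : ∀ i, A i) : ℕ → Hist N A X → ℝ
  | 0, _ => 1
  | k + 1, H =>
      ∑ l : Fin N,
        if ∀ e ∈ H, e.1 ≠ l then
          q H l * o H l (x l) (a l) * causalSum q o x a k (H ++ [⟨l, (a l, x l)⟩])
        else 0

end CIQ

end

namespace CIQ

section Norm

variable {N T : ℕ} {S : Type} [Fintype S]
variable {A : Fin N → Type} [∀ i, Fintype (A i)]

lemma nsq_nonneg (v : Idx N T S A → ℂ) : 0 ≤ nsq v :=
  Finset.sum_nonneg fun _ _ => Complex.normSq_nonneg _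

lemma nsq_eq_zero {v : Idx N T S A → ℂ} : nsq v = 0 ↔ ∀ p, v p = 0 := by
  unfold nsq
  rw [Finset.sum_eq_zero_iff_of_nonneg fun _ _ => Complex.normSq_nonneg _]
  simp

lemma nsq_mono {v w : Idx N T S A → ℂ} (h : ∀ p, v p ≠ 0 → v p = w p) : nsq v ≤ nsq w := by
  refine Finset.sum_le_sum fun p _ => ?_
  by_cases hp : v p = 0
  · simp [hp, Complex.normSq_nonneg]
  · rw [h p hp]

lemma ofReal_nsq (v : Idx N T S A → ℂ) : (nsq v : ℂ) = star v ⬝ᵥ v := by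
  simp [nsq, dotProduct, Complex.normSq_eq_conj_mul_self]

lemma nsq_mulVec [DecidableEq S] [∀ i, DecidableEq (A i)]
    {M : Matrix (Idx N T S A) (Idx N T S A) ℂ}
    (hM : M ∈ Matrix.unitaryGroup (Idx N T S A) ℂ) (v : Idx N T S A → ℂ) :
    nsq (M.mulVec v) = nsq v := by
  have h := Matrix.mem_unitaryGroup_iff'.1 hM
  rw [Matrix.star_eq_conjTranspose] at h
  have : (nsq (M.mulVec v) : ℂ) = nsq v := by
    rw [ofReal_nsq, ofReal_nsq, Matrix.star_mulVec, Matrix.dotProduct_mulVec,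
      Matrix.vecMul_vecMul, h, Matrix.vecMul_one]
  exact_mod_cast this

/-- Pythagoras for the decomposition of a vector along the fibres of a labelling. -/
lemma sum_nsq_fiber {β : Type*} [Fintype β] (f : Idx N T S A → β) (v : Idx N T S A → ℂ) :
    ∑ b, nsq (Set.indicator {p | f p = b} v) = nsq v := by
  classical
  unfold nsq
  rw [Finset.sum_comm]
  refine Finset.sum_congr rfl fun p _ => ?_
  rw [Finset.sum_eq_single (f p)]
  · simp
  · intro b _ hb
    simp [Set.indicator, hb.symm]
  · simp

end Norm

section ExtSC

variable {N T : ℕ} {S : Type} [Fintype S]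
variable {A : Fin N → Type} [∀ i, Fintype (A i)] [∀ i, DecidableEq (A i)]

lemma extSC_mulVec (M : Matrix (S × Fin (N + 1)) (S × Fin (N + 1)) ℂ)
    (v : Idx N T S A → ℂ) (p : Idx N T S A) :
    (extSC M).mulVec v p = ∑ y : S × Fin (N + 1), M (p.1, p.2.1) y * v (y.1, y.2, p.2.2) := by
  simp only [Matrix.mulVec, dotProduct, extSC]
  rw [Fintype.sum_prod_type, Fintype.sum_prod_type]
  refine Finset.sum_congr rfl fun s _ => ?_
  rw [Fintype.sum_prod_type]
  refine Finset.sum_congr rfl fun c _ => ?_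
  rw [Finset.sum_eq_single p.2.2]
  · simp
  · intro b _ hb
    simp [hb.symm]
  · simp

lemma extSC_mem_unitaryGroup [DecidableEq S]
    {M : Matrix (S × Fin (N + 1)) (S × Fin (N + 1)) ℂ}
    (hM : M ∈ Matrix.unitaryGroup (S × Fin (N + 1)) ℂ) :
    (extSC M : Matrix (Idx N T S A) (Idx N T S A) ℂ) ∈ Matrix.unitaryGroup (Idx N T S A) ℂ := by
  rw [Matrix.mem_unitaryGroup_iff] at hM ⊢
  ext p q
  have h := congrFun (congrFun hM (p.1, p.2.1)) (q.1, q.2.1)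
  have h2 := extSC_mulVec M (fun m => star (extSC M : Matrix (Idx N T S A) (Idx N T S A) ℂ) m q) p
  change (extSC M).mulVec (fun m => star (extSC M : Matrix (Idx N T S A) (Idx N T S A) ℂ) m q) p = _
  rw [h2]
  obtain ⟨s, c, d⟩ := p
  obtain ⟨s', c', d'⟩ := q
  by_cases hd : d' = d
  · subst hd
    simp only [Matrix.mul_apply, Matrix.star_apply, Matrix.one_apply, Prod.mk.injEq] at h
    simpa [extSC, Matrix.star_apply, Matrix.one_apply] using h
  · simp [extSC, Matrix.star_apply, hd, Ne.symm hd]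

/-- An operator on system and control commutes with projections on results and flags. -/
lemma extSC_mulVec_indicator (M : Matrix (S × Fin (N + 1)) (S × Fin (N + 1)) ℂ)
    (g : ((i : Fin N) → A i) × ((i : Fin N) → Fin (T + 1)) → Prop) (v : Idx N T S A → ℂ) :
    (extSC M).mulVec (Set.indicator {p | g p.2.2} v) =
      Set.indicator {p | g p.2.2} ((extSC M).mulVec v) := by
  classical
  funext p
  rw [extSC_mulVec]
  by_cases hp : g p.2.2
  · rw [Set.indicator_of_mem (by exact hp), extSC_mulVec]
    simp [Set.indicator, hp]
  · rw [Set.indicator_of_notMem (by exact hp)]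
    simp [Set.indicator, hp]

lemma exists_of_extSC_mulVec_ne_zero {M : Matrix (S × Fin (N + 1)) (S × Fin (N + 1)) ℂ}
    {v : Idx N T S A → ℂ} {p : Idx N T S A} (h : (extSC M).mulVec v p ≠ 0) :
    ∃ m, v m ≠ 0 ∧ m.2.2 = p.2.2 := by
  rw [extSC_mulVec] at h
  obtain ⟨y, -, hy⟩ := Finset.exists_ne_zero_of_sum_ne_zero h
  exact ⟨_, right_ne_zero_of_mul hy, rfl⟩

end ExtSC

namespace Protocol

variable {N T : ℕ} {S : Type} [Fintype S] [DecidableEq S]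
variable {A : Fin N → Type} [∀ i, Fintype (A i)] [∀ i, DecidableEq (A i)]
variable {X : Fin N → Type}

section Activation

variable (P : Protocol N T S A X) (x : ∀ l, X l)

lemma Vmat_mulVec_zero (v : Idx N T S A → ℂ) (s : S) (d) :
    (P.Vmat x).mulVec v (s, 0, d) = v (s, 0, d) := by
  simp [Matrix.mulVec, dotProduct, Vmat]

omit [Fintype S] [∀ i, Fintype (A i)] in
lemma Vmat_succ_apply (s : S) (l : Fin N) (r : ∀ i, A i) (f : Fin N → Fin (T + 1))
    (m : Idx N T S A) :
    P.Vmat x (s, l.succ, r, f) m =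
      if m.2.1 = l.succ ∧ (∀ i, i ≠ l → m.2.2.1 i = r i) ∧ (∀ i, i ≠ l → m.2.2.2 i = f i)
        ∧ m.2.2.2 l + 1 = f l then
        P.Vm l (x l) (s, r l) (m.1, m.2.2.1 l) else 0 := by
  rw [Vmat, dif_neg (Fin.succ_ne_zero l)]
  rfl

lemma Vmat_mulVec_succ (v : Idx N T S A → ℂ) (s : S) (l : Fin N) (r : ∀ i, A i)
    (f : Fin N → Fin (T + 1)) :
    (P.Vmat x).mulVec v (s, l.succ, r, f) =
      ∑ y : S × A l, P.Vm l (x l) (s, r l) y *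
        v (y.1, l.succ, Function.update r l y.2, Function.update f l (f l - 1)) := by
  simp only [Matrix.mulVec, dotProduct, Vmat_succ_apply]
  symm
  refine Finset.sum_of_injOn
    (fun y : S × A l => ((y.1, l.succ, Function.update r l y.2,
      Function.update f l (f l - 1)) : Idx N T S A)) ?_ (by simp) ?_ ?_
  · rintro ⟨s1, b1⟩ - ⟨s2, b2⟩ - h
    simp only [Prod.mk.injEq] at h
    have := congrFun h.2.2.1 l
    simp only [Function.update_self] at this
    simp [h.1, this]
  · rintro ⟨s', c', r', f'⟩ - hm
    rw [if_neg, zero_mul]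
    rintro ⟨h1, h2, h3, h4⟩
    refine hm ⟨(s', r' l), by simp, ?_⟩
    simp only at h1 h2 h3 h4
    simp only [Prod.mk.injEq, true_and]
    refine ⟨h1.symm, ?_, ?_⟩
    · funext i
      by_cases hi : i = l
      · subst hi; simp
      · simp [hi, h2 i hi]
    · funext i
      by_cases hi : i = l
      · subst hi; simp [← h4]
      · simp [hi, h3 i hi]
  · rintro ⟨s', b⟩ -
    rw [if_pos]
    · simp
    · refine ⟨rfl, fun i hi => by simp [hi], fun i hi => by simp [hi], by simp⟩

variable {P} in
lemma Vmat_mem_unitaryGroup (hVm : P.unitaryVm) :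
    P.Vmat x ∈ Matrix.unitaryGroup (Idx N T S A) ℂ := by
  rw [Matrix.mem_unitaryGroup_iff]
  ext p q
  change (P.Vmat x).mulVec (fun m => star (P.Vmat x) m q) p = _
  obtain ⟨s, c, r, f⟩ := p
  obtain ⟨s', c', r', f'⟩ := q
  refine Fin.cases ?_ (fun l => ?_) c
  · rw [Vmat_mulVec_zero]
    refine Fin.cases ?_ (fun l' => ?_) c'
    · simp [Matrix.star_apply, Vmat, Matrix.one_apply]
    · simp [Matrix.star_apply, Vmat, (Fin.succ_ne_zero l').symm]
  · rw [Vmat_mulVec_succ]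
    refine Fin.cases ?_ (fun l' => ?_) c'
    · simp [Matrix.star_apply, Vmat]
    · simp only [Matrix.star_apply, Vmat_succ_apply]
      by_cases hll : l = l'
      · subst hll
        have hu := Matrix.mem_unitaryGroup_iff.1 (hVm l (x l))
        have h := congrFun (congrFun hu (s, r l)) (s', r' l)
        simp only [Matrix.mul_apply, Matrix.star_apply, Matrix.one_apply, Prod.mk.injEq] at h
        by_cases hr : (∀ i, i ≠ l → r i = r' i) ∧ (∀ i, i ≠ l → f i = f' i) ∧ f l = f' l
        · have hf : f = f' := by
            funext i
            by_cases hi : i = l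
            · subst hi; exact hr.2.2
            · exact hr.2.1 i hi
          subst hf
          have hrr : r l = r' l ↔ r = r' := by
            refine ⟨fun h => ?_, fun h => by rw [h]⟩
            funext i
            by_cases hi : i = l
            · subst hi; exact h
            · exact hr.1 i hi
          simp only [hrr] at h
          rw [Matrix.one_apply]
          simp only [Prod.mk.injEq, true_and, and_true]
          rw [← h]
          refine Finset.sum_congr rfl fun y _ => ?_
          rw [if_pos]
          · simp
          · refine ⟨fun i hi => by simp [hi, hr.1 i hi], fun i hi => by simp [hi],
              by simp⟩
        · rw [Matrix.one_apply, if_neg]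
          · refine Finset.sum_eq_zero fun y _ => ?_
            rw [if_neg, star_zero, mul_zero]
            rintro ⟨-, h1, h2, h3⟩
            refine hr ⟨fun i hi => ?_, fun i hi => ?_, ?_⟩
            · simpa [hi] using h1 i hi
            · simpa [hi] using h2 i hi
            · simpa using h3
          · simp only [Prod.mk.injEq, true_and]
            rintro ⟨-, h1, h2⟩
            subst h1 h2
            exact hr ⟨fun _ _ => rfl, fun _ _ => rfl, rfl⟩
      · simp [hll]

/-- Projections on control, results and flags can be pulled through the activation `V`
when on each control sector `l` they ignore the system and the register `r_l`. -/
lemma Vmat_mulVec_indicator {g g' : Idx N T S A → Prop} (v : Idx N T S A → ℂ)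
    (h0 : ∀ s d, g' (s, 0, d) ↔ g (s, 0, d))
    (h1 : ∀ (l : Fin N) s r f s' b, g' (s, l.succ, r, f) ↔
      g (s', l.succ, Function.update r l b, Function.update f l (f l - 1))) :
    Set.indicator {p | g' p} ((P.Vmat x).mulVec v) =
      (P.Vmat x).mulVec (Set.indicator {p | g p} v) := by
  classical
  funext ⟨s, c, r, f⟩
  refine Fin.cases ?_ (fun l => ?_) c
  · rw [Vmat_mulVec_zero, Set.indicator_apply, Set.indicator_apply, Vmat_mulVec_zero]
    simp only [Set.mem_ofPred_eq, h0]
  · rw [Vmat_mulVec_succ]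
    by_cases hg : g' (s, l.succ, r, f)
    · rw [Set.indicator_of_mem (by exact hg), Vmat_mulVec_succ]
      refine Finset.sum_congr rfl fun y _ => ?_
      rw [Set.indicator_of_mem]
      exact (h1 l s r f y.1 y.2).1 hg
    · rw [Set.indicator_of_notMem (by exact hg)]
      symm
      refine Finset.sum_eq_zero fun y _ => ?_
      rw [Set.indicator_of_notMem, mul_zero]
      exact fun h => hg ((h1 l s r f y.1 y.2).2 h)

end Activation

section Dynamics

variable (P : Protocol N T S A X) (x : ∀ l, X l)

/-- The state `V U_t ⋯ V U_1 |0⟩` right after the `t`-th activation. -/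
def post (t : ℕ) : Idx N T S A → ℂ := (P.chain x t).mulVec P.ket0

/-- The state `U_t V ⋯ V U_1 |0⟩` right before the `t`-th activation. -/
def mid (t : ℕ) : Idx N T S A → ℂ := (P.pre x t).mulVec P.ket0

lemma mid_succ (t : ℕ) : P.mid x (t + 1) = (extSC (P.U (t + 1))).mulVec (P.post x t) := by
  simp [mid, post, pre, Matrix.mulVec_mulVec]

lemma post_succ (t : ℕ) : P.post x (t + 1) = (P.Vmat x).mulVec (P.mid x (t + 1)) := by
  simp [mid, post, pre, chain, Matrix.mulVec_mulVec]

lemma post_zero : P.post x 0 = P.ket0 := by simp [post, chain]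

variable {P} in
lemma nsq_indicator_mid (hU : P.unitaryU) {t : ℕ} (ht : t < T)
    (g : ((i : Fin N) → A i) × ((i : Fin N) → Fin (T + 1)) → Prop) :
    nsq (Set.indicator {p | g p.2.2} (P.mid x (t + 1))) =
      nsq (Set.indicator {p | g p.2.2} (P.post x t)) := by
  rw [mid_succ, ← extSC_mulVec_indicator,
    nsq_mulVec (extSC_mem_unitaryGroup (hU _ (by omega) (by omega)))]

variable {P} in
lemma nsq_indicator_post (hVm : P.unitaryVm) (t : ℕ) {g g' : Idx N T S A → Prop}
    (h0 : ∀ s d, g' (s, 0, d) ↔ g (s, 0, d))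
    (h1 : ∀ (l : Fin N) s r f s' b, g' (s, l.succ, r, f) ↔
      g (s', l.succ, Function.update r l b, Function.update f l (f l - 1))) :
    nsq (Set.indicator {p | g' p} (P.post x (t + 1))) =
      nsq (Set.indicator {p | g p} (P.mid x (t + 1))) := by
  rw [post_succ, Vmat_mulVec_indicator P x _ h0 h1, nsq_mulVec (Vmat_mem_unitaryGroup x hVm)]

lemma exists_mid_of_post {t : ℕ} {s : S} {l : Fin N} {r : ∀ i, A i}
    {f : Fin N → Fin (T + 1)} (h : P.post x (t + 1) (s, l.succ, r, f) ≠ 0) :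
    ∃ s' b, P.mid x (t + 1)
      (s', l.succ, Function.update r l b, Function.update f l (f l - 1)) ≠ 0 := by
  rw [post_succ, Vmat_mulVec_succ] at h
  obtain ⟨y, -, hy⟩ := Finset.exists_ne_zero_of_sum_ne_zero h
  exact ⟨_, _, right_ne_zero_of_mul hy⟩

/-- Each activation raises a flag by at most one. -/
lemma flag_le_of_post_ne_zero {t : ℕ} (ht : t ≤ T) {p : Idx N T S A} (h : P.post x t p ≠ 0)
    (i : Fin N) : (p.2.2.2 i : ℕ) ≤ t := by
  induction t generalizing p with
  | zero =>
    rw [post_zero] at h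
    have hp : p = (P.s0, 0, P.r0, fun _ => 0) := by
      by_contra hp
      simp [ket0, hp] at h
    simp [hp]
  | succ t ih =>
    have hmid : ∀ m, P.mid x (t + 1) m ≠ 0 → (m.2.2.2 i : ℕ) ≤ t := by
      intro m hm
      rw [mid_succ] at hm
      obtain ⟨m', hm', he⟩ := exists_of_extSC_mulVec_ne_zero hm
      rw [← he]
      exact ih (by omega) hm'
    obtain ⟨s, c, r, f⟩ := p
    revert h
    refine Fin.cases (fun h => ?_) (fun l h => ?_) c
    · rw [post_succ, Vmat_mulVec_zero] at h
      exact (hmid _ h).trans (by omega)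
    · obtain ⟨s', b, h⟩ := exists_mid_of_post P x h
      have := hmid _ h
      by_cases hi : i = l
      · subst hi
        simp only [Function.update_self] at this
        by_cases h0 : f i = 0
        · simp [h0]
        · rw [Fin.val_sub_one_of_ne_zero h0] at this
          simp only
          omega
      · simp only [ne_eq, hi, not_false_eq_true, Function.update_of_ne] at this
        simp only
        omega

lemma flag_le_of_mid_ne_zero {t : ℕ} (ht : t < T) {p : Idx N T S A}
    (h : P.mid x (t + 1) p ≠ 0) (i : Fin N) : (p.2.2.2 i : ℕ) ≤ t := by
  rw [mid_succ] at h
  obtain ⟨m, hm, he⟩ := exists_of_extSC_mulVec_ne_zero h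
  rw [← he]
  exact flag_le_of_post_ne_zero P x ht.le hm i

lemma flag_ne_zero_of_post_ne_zero {t : ℕ} (ht : t < T) {s : S} {l : Fin N} {r : ∀ i, A i}
    {f : Fin N → Fin (T + 1)} (h : P.post x (t + 1) (s, l.succ, r, f) ≠ 0) : f l ≠ 0 := by
  intro h0
  obtain ⟨s', b, h⟩ := exists_mid_of_post P x h
  have := flag_le_of_mid_ne_zero P x ht h l
  simp only [Function.update_self, h0, zero_sub, Fin.coe_neg_one] at this
  omega

variable {P} (hVm : P.unitaryVm) (hU : P.unitaryU)
include hVm hU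

/-- The weight on a flag having been raised more than once never decreases. -/
lemma nsq_overflow_le_succ (i : Fin N) {t : ℕ} (ht : t < T) :
    nsq (Set.indicator {p | 2 ≤ (p.2.2.2 i : ℕ)} (P.post x t)) ≤
      nsq (Set.indicator {p | 2 ≤ (p.2.2.2 i : ℕ)} (P.post x (t + 1))) := by
  classical
  rw [← nsq_indicator_mid x hU ht (fun d => 2 ≤ (d.2 i : ℕ)),
    ← nsq_indicator_post x hVm t (g := fun p => 2 ≤ (p.2.2.2 i : ℕ))
      (g' := fun p => 2 ≤ ((if p.2.1 = i.succ then p.2.2.2 i - 1 else p.2.2.2 i : Fin (T + 1)) : ℕ))]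
  · refine nsq_mono ?_
    rintro ⟨s, c, r, f⟩ hp
    have hmem := Set.mem_of_indicator_ne_zero hp
    rw [Set.indicator_of_mem hmem] at hp ⊢
    rw [Set.indicator_of_mem]
    simp only [Set.mem_ofPred_eq] at hmem ⊢
    split_ifs at hmem with hc
    · subst hc
      rw [Fin.val_sub_one_of_ne_zero (flag_ne_zero_of_post_ne_zero P x ht hp)] at hmem
      omega
    · exact hmem
  · intro s d
    simp [(Fin.succ_ne_zero i).symm]
  · intro l s r f s' b
    by_cases hl : l = i
    · subst hl; simp
    · simp [hl, Ne.symm hl]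

variable (hflag : P.flagOK x)
include hflag

lemma flag_le_one_of_post_ne_zero {t : ℕ} (ht : t ≤ T) {p : Idx N T S A}
    (h : P.post x t p ≠ 0) (i : Fin N) : (p.2.2.2 i : ℕ) ≤ 1 := by
  have hz : nsq (Set.indicator {p | 2 ≤ (p.2.2.2 i : ℕ)} (P.post x t)) = 0 := by
    induction ht using Nat.decreasingInduction generalizing p with
    | self =>
      rw [nsq_eq_zero]
      intro m
      by_contra hm
      have hmem := Set.mem_of_indicator_ne_zero hm
      rw [Set.indicator_of_mem hmem] at hm
      simp only [Set.mem_ofPred_eq] at hmem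
      rw [hflag m hm i, Fin.val_one'] at hmem
      have := Nat.mod_le 1 (T + 1)
      omega
    | of_succ t ht ih =>
      refine le_antisymm ((nsq_overflow_le_succ x hVm hU i ht).trans ?_) (nsq_nonneg _)
      by_cases hne : ∃ m, P.post x (t + 1) m ≠ 0
      · exact (ih hne.choose_spec).le
      · push Not at hne
        refine (nsq_eq_zero.2 fun m => ?_).le
        simp [Set.indicator, hne]
  by_contra! hlt
  exact h (by simpa [Set.indicator, Nat.succ_le_of_lt hlt] using nsq_eq_zero.1 hz p)

lemma flag_eq_one_of_post_ne_zero {t : ℕ} (ht : t < T) {s : S} {l : Fin N} {r : ∀ i, A i}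
    {f : Fin N → Fin (T + 1)} (h : P.post x (t + 1) (s, l.succ, r, f) ≠ 0) : f l = 1 := by
  have h1 := flag_le_one_of_post_ne_zero x hVm hU hflag ht h l
  have h2 := flag_ne_zero_of_post_ne_zero P x ht h
  rw [Ne, Fin.ext_iff, Fin.val_zero] at h2
  rw [Fin.ext_iff, Fin.val_one', Nat.mod_eq_of_lt (by omega)]
  simp only at h1
  omega

/-- The lab about to be activated has not acted before. -/
lemma flag_eq_zero_of_mid_ne_zero {t : ℕ} (ht : t < T) {s : S} {l : Fin N} {r : ∀ i, A i}
    {f : Fin N → Fin (T + 1)} (h : P.mid x (t + 1) (s, l.succ, r, f) ≠ 0) : f l = 0 := by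
  classical
  have hz := nsq_indicator_post x hVm t
    (g := fun p => p.2.1 = l.succ ∧ p.2.2.2 l ≠ 0)
    (g' := fun p => p.2.1 = l.succ ∧ p.2.2.2 l - 1 ≠ 0)
    (by intro s d; simp [(Fin.succ_ne_zero l).symm])
    (by
      intro l' s r f s' b
      by_cases hl : l' = l
      · subst hl; simp
      · simp [hl])
  rw [nsq_eq_zero.2, eq_comm, nsq_eq_zero] at hz
  · by_contra hne
    exact h (by simpa [Set.indicator, hne] using hz (s, l.succ, r, f))
  · rintro ⟨s, c, r, f⟩
    by_contra hp
    have hmem := Set.mem_of_indicator_ne_zero hp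
    rw [Set.indicator_of_mem hmem] at hp
    obtain ⟨hc, h1⟩ := hmem
    simp only at hc h1
    subst hc
    exact h1 (by rw [flag_eq_one_of_post_ne_zero x hVm hU hflag ht hp, sub_self])

end Dynamics

section Flux

variable [∀ i, Fintype (X i)] [∀ i, DecidableEq (X i)]

/-- The history in which the labs of `L` have acted, with outcomes `a` and settings `x`. -/
def labHist (x : ∀ l, X l) (a : ∀ i, A i) (L : List (Fin N)) : Hist N A X :=
  L.map fun l => ⟨l, (a l, x l)⟩

/-- Exactly the labs of `s` have acted, and their registers show the outcomes `a`. -/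
def ShowsOutcomes (a : ∀ i, A i) (s : Finset (Fin N))
    (d : ((i : Fin N) → A i) × ((i : Fin N) → Fin (T + 1))) : Prop :=
  (∀ i ∈ s, d.1 i = a i ∧ d.2 i = 1) ∧ ∀ i ∉ s, d.2 i = 0

variable (P : Protocol N T S A X) (x : ∀ l, X l) (a : ∀ i, A i)

omit [∀ i, Fintype (A i)] [∀ i, DecidableEq (A i)] [∀ i, Fintype (X i)]
  [∀ i, DecidableEq (X i)] in
lemma histSat_labHist (L : List (Fin N)) (r : ∀ i, A i) (f : Fin N → Fin (T + 1)) :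
    histSat (labHist x a L) r f ↔ ShowsOutcomes a L.toFinset (r, f) := by
  simp only [histSat, ShowsOutcomes, labHist, List.mem_map, List.mem_toFinset]
  constructor
  · rintro ⟨h1, h2⟩
    exact ⟨fun i hi => h1 _ ⟨i, hi, rfl⟩,
      fun i hi => h2 i (by rintro e ⟨j, hj, rfl⟩ rfl; exact hi hj)⟩
  · rintro ⟨h1, h2⟩
    exact ⟨by rintro e ⟨j, hj, rfl⟩; exact h1 j hj,
      fun i hi => h2 i fun hL => hi _ ⟨i, hL, rfl⟩ rfl⟩

lemma psi_labHist (c : Fin (N + 1)) (t : ℕ) (L : List (Fin N)) :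
    P.psi x c t (labHist x a L) =
      Set.indicator {p | p.2.1 = c ∧ ShowsOutcomes a L.toFinset p.2.2} (P.mid x t) := by
  classical
  funext p
  simp only [psi, histSat_labHist, Set.indicator_apply, Set.mem_ofPred_eq, mid]

lemma phiOf_eq_indicator (l : Fin N) (b : A l) (t : ℕ) (H : Hist N A X) :
    P.phiOf x l b t H =
      Set.indicator {p | p.2.2.1 l = b} ((P.Vmat x).mulVec (P.psi x l.succ t H)) := by
  classical
  funext p
  simp only [phiOf, Set.indicator_apply, Set.mem_ofPred_eq]

lemma phiOf_labHist_erase {s : Finset (Fin N)} {l : Fin N} (hl : l ∈ s) (t : ℕ) :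
    P.phiOf x l (a l) (t + 1) (labHist x a (s.erase l).toList) =
      Set.indicator {p | p.2.1 = l.succ}
        (Set.indicator {p | ShowsOutcomes a s p.2.2} (P.post x (t + 1))) := by
  classical
  rw [phiOf_eq_indicator, psi_labHist, Finset.toList_toFinset,
    ← Vmat_mulVec_indicator P x (g' := fun p => p.2.1 = l.succ ∧
      (∀ i ∈ s, i ≠ l → p.2.2.1 i = a i ∧ p.2.2.2 i = 1) ∧ p.2.2.2 l = 1 ∧
        ∀ i ∉ s, p.2.2.2 i = 0), ← post_succ, Set.indicator_indicator, Set.indicator_indicator]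
  · congr 1
    ext p
    simp only [Set.mem_inter_iff, Set.mem_ofPred_eq, ShowsOutcomes]
    constructor
    · rintro ⟨h1, h2, h3, h4, h5⟩
      refine ⟨h2, fun i hi => ?_, h5⟩
      by_cases hil : i = l
      · subst hil; exact ⟨h1, h4⟩
      · exact h3 i hi hil
    · rintro ⟨h2, h3, h5⟩
      exact ⟨(h3 l hl).1, h2, fun i hi _ => h3 i hi, (h3 l hl).2, h5⟩
  · intro u d
    simp [(Fin.succ_ne_zero l).symm]
  · intro l' u r f u' b
    by_cases hll : l' = l
    · subst hll
      simp only [ShowsOutcomes, true_and, Finset.mem_erase]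
      constructor
      · rintro ⟨h1, h2, h3⟩
        refine ⟨fun i hi => ?_, fun i hi => ?_⟩
        · simpa [hi.1] using h1 i hi.2 hi.1
        · by_cases hil : i = l'
          · subst hil; simp [h2]
          · simpa [hil] using h3 i fun his => hi ⟨hil, his⟩
      · rintro ⟨h1, h2⟩
        refine ⟨fun i hi hil => by simpa [hil] using h1 i ⟨hil, hi⟩, ?_, fun i hi => ?_⟩
        · simpa [sub_eq_zero] using h2 l' (by simp)
        · have hil : i ≠ l' := by rintro rfl; exact hi hl
          simpa [hil] using h2 i fun h => hi h.2
    · simp [hll]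

/-- The weight after `t` steps on the labs of `s` having acted with outcomes `a`. -/
noncomputable def outcomeWeight (t : ℕ) (s : Finset (Fin N)) : ℝ :=
  nsq (Set.indicator {p | ShowsOutcomes a s p.2.2} (P.post x t))

variable {P} (hVm : P.unitaryVm) (hU : P.unitaryU)
include hVm

lemma sum_numPhi (H : Hist N A X) (l : Fin N) : ∑ b, P.numPhi x H l b = P.numPsi x H l := by
  simp only [numPhi, numPsi]
  rw [Finset.sum_comm]
  refine Finset.sum_congr rfl fun t _ => ?_
  simp only [phiOf_eq_indicator]
  rw [sum_nsq_fiber (fun p : Idx N T S A => p.2.2.1 l),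
    nsq_mulVec (Vmat_mem_unitaryGroup x hVm)]

variable (hflag : P.flagOK x)
include hU hflag

lemma outcomeWeight_succ (s : Finset (Fin N)) {t : ℕ} (ht : t < T) :
    P.outcomeWeight x a (t + 1) s +
        ∑ l ∈ sᶜ, nsq (P.psi x l.succ (t + 1) (labHist x a s.toList)) =
      P.outcomeWeight x a t s +
        ∑ l ∈ s, nsq (P.phiOf x l (a l) (t + 1) (labHist x a (s.erase l).toList)) := by
  classical
  have hpre : P.outcomeWeight x a t s =
      nsq (P.psi x 0 (t + 1) (labHist x a s.toList)) +
        ∑ l ∈ sᶜ, nsq (P.psi x l.succ (t + 1) (labHist x a s.toList)) := by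
    rw [outcomeWeight, ← nsq_indicator_mid x hU ht,
      ← sum_nsq_fiber (fun p : Idx N T S A => p.2.1), Fin.sum_univ_succ]
    simp only [Set.indicator_indicator, psi_labHist, Finset.toList_toFinset]
    congr 1
    symm
    refine Finset.sum_subset (Finset.subset_univ _) fun l _ hl => ?_
    rw [Finset.mem_compl, not_not] at hl
    rw [nsq_eq_zero]
    rintro ⟨u, c, r, f⟩
    by_contra hp
    have hmem := Set.mem_of_indicator_ne_zero hp
    rw [Set.indicator_of_mem hmem] at hp
    obtain ⟨hc, h1⟩ := hmem
    simp only at hc h1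
    subst hc
    have h0 := flag_eq_zero_of_mid_ne_zero x hVm hU hflag ht hp
    rw [show f l = 1 from (h1.1 l hl).2, Fin.one_eq_zero_iff] at h0
    omega
  have hpost : P.outcomeWeight x a (t + 1) s =
      nsq (P.psi x 0 (t + 1) (labHist x a s.toList)) +
        ∑ l ∈ s, nsq (P.phiOf x l (a l) (t + 1) (labHist x a (s.erase l).toList)) := by
    rw [outcomeWeight, ← sum_nsq_fiber (fun p : Idx N T S A => p.2.1), Fin.sum_univ_succ]
    congr 1
    · rw [psi_labHist, Finset.toList_toFinset, Set.indicator_indicator]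
      refine nsq_indicator_post x hVm t (g := fun p => p.2.1 = 0 ∧ ShowsOutcomes a s p.2.2)
        (g' := fun p => p.2.1 = 0 ∧ ShowsOutcomes a s p.2.2) (fun _ _ => Iff.rfl) ?_
      intro l
      simp
    · symm
      rw [← Finset.sum_subset (Finset.subset_univ s)]
      · exact Finset.sum_congr rfl fun l hl => by rw [phiOf_labHist_erase P x a hl]
      · intro l _ hl
        rw [nsq_eq_zero]
        rintro ⟨u, c, r, f⟩
        by_contra hp
        have hmem := Set.mem_of_indicator_ne_zero hp
        rw [Set.indicator_of_mem hmem] at hp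
        have hmem' := Set.mem_of_indicator_ne_zero hp
        rw [Set.indicator_of_mem hmem'] at hp
        simp only [Set.mem_ofPred_eq] at hmem hmem'
        subst hmem
        have h1 := flag_eq_one_of_post_ne_zero x hVm hU hflag ht hp
        rw [show f l = 0 from hmem'.2 l hl, eq_comm, Fin.one_eq_zero_iff] at h1
        omega
  rw [hpre, hpost]
  ring

/-- Conservation of weight: what flows into the labs of `s` having acted either flows on
to further labs or remains until the end of the protocol. -/
lemma outcomeWeight_add_denPsi (s : Finset (Fin N)) :
    P.outcomeWeight x a T s + P.denPsi x (labHist x a s.toList) =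
      P.outcomeWeight x a 0 s +
        ∑ l ∈ s, P.numPhi x (labHist x a (s.erase l).toList) l (a l) := by
  have hden : P.denPsi x (labHist x a s.toList) =
      ∑ t ∈ Finset.range T, ∑ l ∈ sᶜ, nsq (P.psi x l.succ (t + 1) (labHist x a s.toList)) := by
    rw [Finset.sum_comm, denPsi]
    refine Finset.sum_congr ?_ fun l _ => ?_
    · ext l
      simp only [Finset.mem_filter, Finset.mem_univ, true_and, Finset.mem_compl, labHist,
        List.forall_mem_map, Finset.mem_toList]
      exact ⟨fun h hl => h l hl rfl, fun h j hj hjl => h (hjl ▸ hj)⟩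
    · rw [numPsi, Finset.range_eq_Ico, Finset.sum_Ico_add' (fun t =>
        nsq (P.psi x l.succ t (labHist x a s.toList))) 0 T 1]
      rfl
  have hnum : ∑ l ∈ s, P.numPhi x (labHist x a (s.erase l).toList) l (a l) =
      ∑ t ∈ Finset.range T,
        ∑ l ∈ s, nsq (P.phiOf x l (a l) (t + 1) (labHist x a (s.erase l).toList)) := by
    rw [Finset.sum_comm]
    refine Finset.sum_congr rfl fun l _ => ?_
    rw [numPhi, Finset.range_eq_Ico, Finset.sum_Ico_add' (fun t =>
      nsq (P.phiOf x l (a l) t (labHist x a (s.erase l).toList))) 0 T 1]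
    rfl
  have htel := Finset.sum_range_sub (fun t => P.outcomeWeight x a t s) T
  have hstep : ∑ t ∈ Finset.range T, (P.outcomeWeight x a (t + 1) s - P.outcomeWeight x a t s) =
      ∑ t ∈ Finset.range T,
        (∑ l ∈ s, nsq (P.phiOf x l (a l) (t + 1) (labHist x a (s.erase l).toList)) -
        ∑ l ∈ sᶜ, nsq (P.psi x l.succ (t + 1) (labHist x a s.toList))) :=
    Finset.sum_congr rfl fun t ht => by
      linarith [outcomeWeight_succ x a hVm hU hflag s (Finset.mem_range.1 ht)]
  rw [htel, Finset.sum_sub_distrib, ← hden, ← hnum] at hstep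
  linarith

omit [∀ i, Fintype (X i)] [∀ i, DecidableEq (X i)] hVm hU in
lemma outcomeWeight_final_eq_zero {s : Finset (Fin N)} (hs : s ≠ Finset.univ) (hT : 1 ≤ T) :
    P.outcomeWeight x a T s = 0 := by
  obtain ⟨i, hi⟩ : ∃ i, i ∉ s := by
    by_contra! h
    exact hs (Finset.eq_univ_of_forall h)
  refine nsq_eq_zero.2 fun p => ?_
  by_contra hp
  have hmem := Set.mem_of_indicator_ne_zero hp
  rw [Set.indicator_of_mem hmem] at hp
  have h1 := hflag p hp i
  rw [hmem.2 i hi, eq_comm, Fin.one_eq_zero_iff] at h1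
  omega

omit [∀ i, Fintype (X i)] [∀ i, DecidableEq (X i)] hVm hU in
lemma outcomeWeight_final_univ : P.outcomeWeight x a T Finset.univ = P.pQ x a := by
  classical
  unfold outcomeWeight pQ
  congr 1
  funext p
  by_cases hp : (P.Uop x).mulVec P.ket0 p = 0
  · have hp' : P.post x T p = 0 := hp
    simp [Set.indicator, hp, hp']
  · have hf := hflag p hp
    simp only [Set.indicator_apply, Set.mem_ofPred_eq, ShowsOutcomes, Finset.mem_univ, true_imp_iff,
      hf, and_true, not_true, false_imp_iff, implies_true, funext_iff]
    rfl

omit [∀ i, Fintype (X i)] [∀ i, DecidableEq (X i)] hVm hU hflag in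
lemma outcomeWeight_zero_of_nonempty {s : Finset (Fin N)} (hs : s.Nonempty) (hT : 1 ≤ T) :
    P.outcomeWeight x a 0 s = 0 := by
  obtain ⟨i, hi⟩ := hs
  refine nsq_eq_zero.2 fun p => ?_
  by_contra hp
  have hmem := Set.mem_of_indicator_ne_zero hp
  rw [Set.indicator_of_mem hmem, post_zero] at hp
  have hp0 : p = (P.s0, 0, P.r0, fun _ => 0) := by
    by_contra hne
    simp [ket0, hne] at hp
  have h1 := (hmem.1 i hi).2
  rw [hp0, eq_comm, Fin.one_eq_zero_iff] at h1
  omega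

omit [∀ i, Fintype (X i)] [∀ i, DecidableEq (X i)] hVm hU hflag in
lemma outcomeWeight_zero_empty : P.outcomeWeight x a 0 ∅ = 1 := by
  classical
  unfold outcomeWeight nsq
  rw [Finset.sum_eq_single (P.s0, 0, P.r0, fun _ => 0)]
  · simp [post_zero, ket0, Set.indicator, ShowsOutcomes]
  · intro p _ hp
    simp [post_zero, ket0, Set.indicator, hp]
  · simp

end Flux

end Protocol

section SetSum

variable {ι : Type*} [Fintype ι] [DecidableEq ι]

/-- Sum over the orders in which `k` further elements can join the set `s`, where `l` joins
`s` with weight `n s l / d s`. -/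
noncomputable def setSum (n : Finset ι → ι → ℝ) (d : Finset ι → ℝ) : ℕ → Finset ι → ℝ
  | 0, _ => 1
  | k + 1, s => ∑ l ∈ sᶜ, n s l / d s * setSum n d k (insert l s)

variable {n : Finset ι → ι → ℝ} {d : Finset ι → ℝ}

lemma sum_powersetCard_mul_setSum_succ (hd : ∀ s l, l ∉ s → d s = 0 → n s l = 0) (k m : ℕ) :
    ∑ s ∈ Finset.powersetCard k Finset.univ, d s * setSum n d (m + 1) s =
      ∑ s ∈ Finset.powersetCard (k + 1) Finset.univ,
        (∑ l ∈ s, n (s.erase l) l) * setSum n d m s := by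
  have h1 : ∀ s, d s * setSum n d (m + 1) s =
      ∑ l ∈ sᶜ, n s l * setSum n d m (insert l s) := by
    intro s
    rw [setSum, Finset.mul_sum]
    refine Finset.sum_congr rfl fun l hl => ?_
    by_cases h : d s = 0
    · simp [h, hd s l (Finset.mem_compl.1 hl) h]
    · field_simp
  simp only [h1, Finset.sum_mul]
  rw [Finset.sum_sigma', Finset.sum_sigma']
  refine Finset.sum_bij' (fun y _ => ⟨insert y.2 y.1, y.2⟩) (fun y _ => ⟨y.1.erase y.2, y.2⟩)
    ?_ ?_ ?_ ?_ ?_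
  all_goals
    rintro ⟨s, l⟩ hy
    simp only [Finset.mem_sigma, Finset.mem_powersetCard_univ, Finset.mem_compl] at hy ⊢
  · exact ⟨by rw [Finset.card_insert_of_notMem hy.2, hy.1], Finset.mem_insert_self _ _⟩
  · exact ⟨by rw [Finset.card_erase_of_mem hy.2, hy.1, Nat.add_sub_cancel], by simp⟩
  · rw [Finset.erase_insert hy.2]
  · rw [Finset.insert_erase hy.2]
  · rw [Finset.erase_insert hy.2]

/-- If the weight `d` is conserved under single elements joining a set, the total weight of
all orders equals the weight flowing into the full set. -/
lemma mul_setSum_empty (hd : ∀ s l, l ∉ s → d s = 0 → n s l = 0)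
    (hflow : ∀ s, s.Nonempty → s ≠ Finset.univ → d s = ∑ l ∈ s, n (s.erase l) l)
    (hι : 0 < Fintype.card ι) :
    d ∅ * setSum n d (Fintype.card ι) ∅ = ∑ l, n (Finset.univ.erase l) l := by
  have key : ∀ m k, k + (m + 1) = Fintype.card ι →
      ∑ s ∈ Finset.powersetCard k Finset.univ, d s * setSum n d (m + 1) s =
        ∑ l, n (Finset.univ.erase l) l := by
    intro m
    induction m with
    | zero =>
      intro k hk
      rw [sum_powersetCard_mul_setSum_succ hd, hk, ← Finset.card_univ, Finset.powersetCard_self]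
      simp [setSum]
    | succ m ih =>
      intro k hk
      rw [sum_powersetCard_mul_setSum_succ hd, ← ih (k + 1) (by omega)]
      refine Finset.sum_congr rfl fun s hs => ?_
      rw [Finset.mem_powersetCard_univ] at hs
      rw [hflow s (Finset.card_pos.1 (by omega))]
      rintro rfl
      rw [Finset.card_univ] at hs
      omega
  have := key (Fintype.card ι - 1) 0 (by omega)
  rwa [Nat.sub_add_cancel hι, Finset.powersetCard_zero, Finset.sum_singleton] at this

end SetSum

namespace Protocol

variable {N T : ℕ} {S : Type} [Fintype S] [DecidableEq S]
variable {A : Fin N → Type} [∀ i, Fintype (A i)] [∀ i, DecidableEq (A i)]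
variable {X : Fin N → Type} [∀ i, Fintype (X i)] [∀ i, DecidableEq (X i)]
variable (P : Protocol N T S A X) (x : ∀ l, X l) (a : ∀ i, A i)

lemma numPhi_nonneg (H : Hist N A X) (l : Fin N) (b : A l) : 0 ≤ P.numPhi x H l b :=
  Finset.sum_nonneg fun _ _ => nsq_nonneg _

lemma numPsi_nonneg (H : Hist N A X) (l : Fin N) : 0 ≤ P.numPsi x H l :=
  Finset.sum_nonneg fun _ _ => nsq_nonneg _

omit [∀ i, Fintype (A i)] [∀ i, DecidableEq (A i)] [∀ i, Fintype (X i)]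
  [∀ i, DecidableEq (X i)] in
lemma forall_labHist_fst_ne (L : List (Fin N)) (l : Fin N) :
    (∀ e ∈ labHist x a L, e.1 ≠ l) ↔ l ∉ L := by
  simp only [labHist, List.forall_mem_map]
  exact ⟨fun h hl => h l hl rfl, fun h j hj hjl => h (hjl ▸ hj)⟩

lemma numPsi_labHist_toList (L : List (Fin N)) (l : Fin N) :
    P.numPsi x (labHist x a L.toFinset.toList) l = P.numPsi x (labHist x a L) l := by
  simp [numPsi, psi_labHist]

lemma numPhi_labHist_toList (L : List (Fin N)) (l : Fin N) (b : A l) :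
    P.numPhi x (labHist x a L.toFinset.toList) l b = P.numPhi x (labHist x a L) l b := by
  simp [numPhi, phiOf_eq_indicator, psi_labHist]

lemma denPsi_labHist_toList (L : List (Fin N)) :
    P.denPsi x (labHist x a L.toFinset.toList) = P.denPsi x (labHist x a L) := by
  simp only [denPsi, numPsi_labHist_toList, forall_labHist_fst_ne, Finset.mem_toList,
    List.mem_toFinset]

variable {P}

lemma numPhi_eq_zero_of_numPsi (hVm : P.unitaryVm) {H : Hist N A X} {l : Fin N}
    (h : P.numPsi x H l = 0) (b : A l) : P.numPhi x H l b = 0 := by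
  rw [← sum_numPhi x hVm H l,
    Finset.sum_eq_zero_iff_of_nonneg fun b _ => numPhi_nonneg P x H l b] at h
  exact h b (Finset.mem_univ b)

lemma numPsi_eq_zero_of_denPsi {H : Hist N A X} {l : Fin N} (hl : ∀ e ∈ H, e.1 ≠ l)
    (h : P.denPsi x H = 0) : P.numPsi x H l = 0 := by
  rw [denPsi, Finset.sum_eq_zero_iff_of_nonneg fun l _ => numPsi_nonneg P x H l] at h
  exact h l (by simpa using hl)

variable (hVm : P.unitaryVm) (hU : P.unitaryU) (hflag : P.flagOK x)
include hVm hU hflag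

lemma denPsi_eq_sum_numPhi (hT : 1 ≤ T) {s : Finset (Fin N)} (hs : s.Nonempty)
    (hs' : s ≠ Finset.univ) :
    P.denPsi x (labHist x a s.toList) =
      ∑ l ∈ s, P.numPhi x (labHist x a (s.erase l).toList) l (a l) := by
  have h := outcomeWeight_add_denPsi x a hVm hU hflag s
  rwa [outcomeWeight_final_eq_zero x a hflag hs' hT, outcomeWeight_zero_of_nonempty x a hs hT,
    zero_add, zero_add] at h

variable {q : Hist N A X → Fin N → ℝ} {o : Hist N A X → (l : Fin N) → X l → A l → ℝ}

/-- Along histories of positive weight the arbitrary conventions for vanishing denominators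
do not matter, and the causal sum depends only on the set of labs that have acted. -/
lemma causalSum_labHist_eq_setSum (hT : 1 ≤ T)
    (hq : ∀ (H : Hist N A X) (l : Fin N), labsDistinct H → (∀ e ∈ H, e.1 ≠ l) →
      P.denPsi x H ≠ 0 → q H l = P.pNext x H l)
    (ho : ∀ (H : Hist N A X) (l : Fin N) (a : A l), labsDistinct H →
      (∀ e ∈ H, e.1 ≠ l) → (∑ a' : A l, P.numPhi x H l a') ≠ 0 →
      o H l (x l) a = P.pOut x H l a)
    (k : ℕ) {L : List (Fin N)} (hL : L.Nodup) (hk : L.length + k = N)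
    (hpos : 0 < k → P.denPsi x (labHist x a L) ≠ 0) :
    causalSum q o x a k (labHist x a L) =
      setSum (fun s l => P.numPhi x (labHist x a s.toList) l (a l))
        (fun s => P.denPsi x (labHist x a s.toList)) k L.toFinset := by
  induction k generalizing L with
  | zero => rfl
  | succ k ih =>
    have hdist : labsDistinct (labHist x a L) := by
      simpa [labsDistinct, labHist, List.map_map, Function.comp_def] using hL
    have hden := hpos k.succ_pos
    rw [causalSum, setSum, ← Finset.sum_filter]
    refine Finset.sum_congr ?_ fun l hl => ?_
    · ext l
      simp [forall_labHist_fst_ne]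
    have hlL : l ∉ L := by simpa using hl
    have hlH := (forall_labHist_fst_ne x a L l).2 hlL
    rw [hq _ l hdist hlH hden, pNext, numPhi_labHist_toList, denPsi_labHist_toList]
    by_cases hphi : P.numPhi x (labHist x a L) l (a l) = 0
    · by_cases hpsi : P.numPsi x (labHist x a L) l = 0
      · simp [hphi, hpsi]
      · rw [ho _ l _ hdist hlH (by rwa [sum_numPhi x hVm]), pOut]
        simp [hphi]
    · have hpsi : P.numPsi x (labHist x a L) l ≠ 0 :=
        fun h => hphi (numPhi_eq_zero_of_numPsi x hVm h _)
      have hins : (L ++ [l]).toFinset = insert l L.toFinset := by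
        ext i
        simp
      rw [ho _ l _ hdist hlH (by rwa [sum_numPhi x hVm]), pOut, sum_numPhi x hVm,
        show labHist x a L ++ [⟨l, (a l, x l)⟩] = labHist x a (L ++ [l]) by simp [labHist],
        ih, hins]
      · field_simp
      · exact hL.append (List.nodup_singleton l) (by simpa using hlL)
      · simp only [List.length_append, List.length_singleton]
        omega
      · intro hk0
        have hne : insert l L.toFinset ≠ Finset.univ := by
          intro h
          have hc := congrArg Finset.card h
          rw [Finset.card_insert_of_notMem (by simpa using hlL), Finset.card_univ,
            Fintype.card_fin, List.toFinset_card_of_nodup hL] at hc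
          omega
        rw [← denPsi_labHist_toList, hins, denPsi_eq_sum_numPhi x a hVm hU hflag hT
          (Finset.insert_nonempty _ _) hne]
        refine (Finset.sum_pos' (fun _ _ => numPhi_nonneg P x _ _ _)
          ⟨l, Finset.mem_insert_self _ _, ?_⟩).ne'
        rw [Finset.erase_insert (by simpa using hlL), numPhi_labHist_toList]
        exact lt_of_le_of_ne (numPhi_nonneg P x _ _ _) (Ne.symm hphi)

end Protocol

end CIQ

open CIQ CIQ.Protocol

/-- With the 'who is next?' probabilities `q` and the 'what did they see?'
probabilities `o` given by Definitions 4–5 (arbitrary where a denominator vanishes),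
the causal-model expression of Definition 1 reproduces the quantum outcome
probabilities `p^quantum(a⃗|x⃗) = ‖(|a⃗⟩⟨a⃗|_r ⊗ I) 𝒰 |0⟩‖²` exactly. -/
theorem defs_four_five_reproduce_quantum
    (N T : ℕ) (S : Type) [Fintype S] [DecidableEq S]
    (A : Fin N → Type) [∀ i, Fintype (A i)] [∀ i, DecidableEq (A i)]
    (X : Fin N → Type) [∀ i, Fintype (X i)] [∀ i, DecidableEq (X i)]
    (hN : 1 ≤ N) (hT : N ≤ T)
    (P : Protocol N T S A X) (hVm : P.unitaryVm) (hU : P.unitaryU)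
    (x : ∀ l, X l) (hflag : P.flagOK x)
    (q : Hist N A X → Fin N → ℝ) (o : Hist N A X → (l : Fin N) → X l → A l → ℝ)
    (hq : ∀ (H : Hist N A X) (l : Fin N), labsDistinct H → (∀ e ∈ H, e.1 ≠ l) →
      P.denPsi x H ≠ 0 → q H l = P.pNext x H l)
    (ho : ∀ (H : Hist N A X) (l : Fin N) (a : A l), labsDistinct H →
      (∀ e ∈ H, e.1 ≠ l) → (∑ a' : A l, P.numPhi x H l a') ≠ 0 →
      o H l (x l) a = P.pOut x H l a)
    (a : ∀ i, A i) :
    causalSum q o x a N [] = P.pQ x a := by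
  have hT1 : 1 ≤ T := hN.trans hT
  have hne : (∅ : Finset (Fin N)) ≠ Finset.univ := by
    intro h
    have hc := congrArg Finset.card h
    rw [Finset.card_empty, Finset.card_univ, Fintype.card_fin] at hc
    omega
  have hden0 : P.denPsi x (labHist x a (∅ : Finset (Fin N)).toList) = 1 := by
    have h := outcomeWeight_add_denPsi x a hVm hU hflag ∅
    rwa [outcomeWeight_final_eq_zero x a hflag hne hT1, outcomeWeight_zero_empty,
      Finset.sum_empty, zero_add, add_zero] at h
  have hfull := outcomeWeight_add_denPsi x a hVm hU hflag Finset.univ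
  have hdenFull : P.denPsi x (labHist x a (Finset.univ : Finset (Fin N)).toList) = 0 := by
    simp [denPsi, forall_labHist_fst_ne]
  rw [outcomeWeight_final_univ x a hflag, hdenFull, add_zero,
    outcomeWeight_zero_of_nonempty x a (Finset.nonempty_iff_ne_empty.2 hne.symm) hT1,
    zero_add] at hfull
  have hsum := mul_setSum_empty
    (n := fun s l => P.numPhi x (labHist x a s.toList) l (a l))
    (d := fun s => P.denPsi x (labHist x a s.toList))
    (fun s l hl h => numPhi_eq_zero_of_numPsi x hVm (numPsi_eq_zero_of_denPsi x
      ((forall_labHist_fst_ne x a _ l).2 (by simpa using hl)) h) _)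
    (fun s hs hs' => denPsi_eq_sum_numPhi x a hVm hU hflag hT1 hs hs')
    (by rw [Fintype.card_fin]; omega)
  rw [hden0, one_mul, Fintype.card_fin] at hsum
  rw [hfull, ← hsum]
  refine causalSum_labHist_eq_setSum (L := []) x a hVm hU hflag hT1 hq ho N List.nodup_nil
    (by simp) fun _ => ?_
  rw [← denPsi_labHist_toList, List.toFinset_nil, hden0]
  exact one_ne_zero
end

section
/- Result 3: under the flag constraint, for any complete history H_N containing all N labs, with outcomes a⃗ = (a_1,…,a_N) and the fixed settings x⃗: Σ_{l_N ∈ ℒ_N} Σ_{t_N=1}^T ‖φ_{(l_N,t_N,H_N)}‖² = ‖(|a⃗⟩⟨a⃗|_r ⊗ I) 𝒰|0⟩‖² = p^quantum(a⃗|x⃗). -/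
open CIQ CIQ.Protocol

namespace CIQ

variable {N T : ℕ} {S : Type} {A X : Fin N → Type}

theorem histSat_filter_ne {H : Hist N A X} (hH : labsDistinct H) {x : ∀ l, X l} {a : ∀ i, A i}
    (hfull : ∀ l : Fin N, (⟨l, (a l, x l)⟩ : (i : Fin N) × (A i × X i)) ∈ H)
    (l : Fin N) (r : ∀ i, A i) (f : Fin N → Fin (T + 1)) :
    histSat (H.filter fun e => decide (e.1 ≠ l)) r f ↔
      (∀ i, i ≠ l → r i = a i ∧ f i = 1) ∧ f l = 0 := by
  have heq : ∀ e ∈ H, e = ⟨e.1, (a e.1, x e.1)⟩ := fun e he =>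
    List.inj_on_of_nodup_map hH he (hfull e.1) rfl
  simp only [histSat, List.mem_filter, decide_eq_true_eq]
  constructor
  · rintro ⟨h₁, h₂⟩
    exact ⟨fun i hi => h₁ _ ⟨hfull i, hi⟩, h₂ l fun e he => he.2⟩
  · rintro ⟨h₁, h₂⟩
    refine ⟨fun e he => ?_, fun i hi => ?_⟩
    · rw [heq e he.1]
      exact h₁ e.1 he.2
    · by_cases hil : i = l
      · rw [hil, h₂]
      · exact absurd rfl (hi _ ⟨hfull i, hil⟩)

variable [Fintype S] [∀ i, Fintype (A i)] [∀ i, DecidableEq (A i)]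

theorem extSC_mulVec_s6 (M : Matrix (S × Fin (N + 1)) (S × Fin (N + 1)) ℂ)
    (v : Idx N T S A → ℂ) (s : S) (c : Fin (N + 1)) (r : ∀ i, A i) (f : Fin N → Fin (T + 1)) :
    (extSC M).mulVec v (s, c, r, f) = M.mulVec (fun q => v (q.1, q.2, r, f)) (s, c) := by
  simp only [Matrix.mulVec, dotProduct]
  symm
  refine Finset.sum_of_injOn (fun q : S × Fin (N + 1) => ((q.1, q.2, r, f) : Idx N T S A))
    ?_ (fun _ _ => Finset.mem_coe.2 (Finset.mem_univ _)) ?_ ?_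
  · rintro ⟨s₁, c₁⟩ - ⟨s₂, c₂⟩ - h
    simpa using h
  · rintro ⟨s', c', r', f'⟩ - h
    have hne : ¬ (r, f) = (r', f') := by
      intro h'
      obtain ⟨rfl, rfl⟩ := Prod.mk.inj h'
      exact h ⟨(s', c'), by simp, rfl⟩
    simp only [extSC]
    rw [if_neg hne, zero_mul]
  · rintro ⟨s', c'⟩ -
    simp [extSC]

theorem nsq_ite_eq (v : Idx N T S A → ℂ) (a : ∀ i, A i) (f : Fin N → Fin (T + 1)) :
    nsq (fun p => if p.2.2 = (a, f) then v p else 0) =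
      ∑ q : S × Fin (N + 1), Complex.normSq (v (q.1, q.2, a, f)) := by
  rw [nsq, Fintype.sum_prod_type, Fintype.sum_prod_type]
  refine Finset.sum_congr rfl fun s _ => ?_
  rw [Fintype.sum_prod_type]
  refine Finset.sum_congr rfl fun c _ => ?_
  rw [Finset.sum_eq_single (a, f)]
  · simp
  · intro b _ hb
    simp [hb]
  · simp

variable [DecidableEq S]

theorem Vmat_mulVec_zero (P : Protocol N T S A X) (x : ∀ l, X l)
    (v : Idx N T S A → ℂ) (s : S) (r : ∀ i, A i) (f : Fin N → Fin (T + 1)) :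
    (P.Vmat x).mulVec v (s, 0, r, f) = v (s, 0, r, f) := by
  simp [Matrix.mulVec, dotProduct, Vmat]

theorem Vmat_mulVec_succ (P : Protocol N T S A X) (x : ∀ l, X l)
    (v : Idx N T S A → ℂ) (s : S) (l : Fin N) (r : ∀ i, A i) (f : Fin N → Fin (T + 1)) :
    (P.Vmat x).mulVec v (s, l.succ, r, f) =
      (P.Vm l (x l)).mulVec (fun q => v (q.1, l.succ, Function.update r l q.2,
        Function.update f l (f l - 1))) (s, r l) := by
  simp only [Matrix.mulVec, dotProduct]
  symm
  refine Finset.sum_of_injOn (fun q : S × A l => ((q.1, l.succ, Function.update r l q.2,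
        Function.update f l (f l - 1)) : Idx N T S A))
    ?_ (fun _ _ => Finset.mem_coe.2 (Finset.mem_univ _)) ?_ ?_
  · rintro ⟨s₁, a₁⟩ - ⟨s₂, a₂⟩ - h
    simp only [Prod.mk.injEq] at h
    have h' := congrFun h.2.2.1 l
    simp only [Function.update_self] at h'
    rw [h.1, h']
  · rintro ⟨s', c', r', f'⟩ - h
    simp only [Vmat]
    rw [dif_neg (Fin.succ_ne_zero l), if_neg, zero_mul]
    rintro ⟨hc, hr, hf, hl⟩
    simp only [Fin.pred_succ] at hc hr hf hl
    refine h ⟨(s', r' l), by simp, ?_⟩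
    simp only [Prod.mk.injEq, true_and]
    refine ⟨hc.symm, ?_, ?_⟩
    · rw [eq_comm, Function.eq_update_iff]
      exact ⟨rfl, hr⟩
    · rw [eq_comm, Function.eq_update_iff]
      exact ⟨eq_sub_of_add_eq hl, hf⟩
  · rintro ⟨s', a'⟩ -
    simp only [Vmat]
    rw [dif_neg (Fin.succ_ne_zero l)]
    generalize hm : l.succ.pred (Fin.succ_ne_zero l) = m
    obtain rfl : l = m := by simpa using hm
    rw [if_pos, Function.update_self]
    exact ⟨trivial, fun i hi => Function.update_of_ne hi _ _,
      fun i hi => Function.update_of_ne hi _ _, by simp⟩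

theorem eq_zero_of_unitary_mulVec_eq_zero {n : Type*} [Fintype n] [DecidableEq n]
    {M : Matrix n n ℂ} (hM : M ∈ Matrix.unitaryGroup n ℂ) {v : n → ℂ}
    (h : M.mulVec v = 0) : v = 0 := by
  have h' := congrArg ((star M).mulVec) h
  rwa [Matrix.mulVec_mulVec, Matrix.mem_unitaryGroup_iff'.1 hM, Matrix.one_mulVec,
    Matrix.mulVec_zero] at h'

theorem sum_normSq_unitary_mulVec {n : Type*} [Fintype n] [DecidableEq n]
    {M : Matrix n n ℂ} (hM : M ∈ Matrix.unitaryGroup n ℂ) (v : n → ℂ) :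
    ∑ i, Complex.normSq (M.mulVec v i) = ∑ i, Complex.normSq (v i) := by
  have key (w : n → ℂ) : ((∑ i, Complex.normSq (w i) : ℝ) : ℂ) = star w ⬝ᵥ w := by
    simp [dotProduct, Complex.normSq_eq_conj_mul_self]
  apply Complex.ofReal_injective
  rw [key, key, Matrix.star_mulVec, ← Matrix.dotProduct_mulVec, Matrix.mulVec_mulVec,
    ← Matrix.star_eq_conjTranspose, Matrix.mem_unitaryGroup_iff'.1 hM, Matrix.one_mulVec]

/-- The state right after the `t`-th activation. -/
def stateAt (P : Protocol N T S A X) (x : ∀ l, X l) (t : ℕ) : Idx N T S A → ℂ :=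
  (P.chain x t).mulVec P.ket0

/-- The state right before the `(t + 1)`-th activation. -/
def preState (P : Protocol N T S A X) (x : ∀ l, X l) (t : ℕ) : Idx N T S A → ℂ :=
  (extSC (P.U (t + 1))).mulVec (stateAt P x t)

theorem stateAt_succ (P : Protocol N T S A X) (x : ∀ l, X l) (t : ℕ) :
    stateAt P x (t + 1) = (P.Vmat x).mulVec (preState P x t) := by
  simp [stateAt, preState, chain, Matrix.mulVec_mulVec]

theorem pre_mulVec_ket0 (P : Protocol N T S A X) (x : ∀ l, X l) (t : ℕ) :
    (P.pre x (t + 1)).mulVec P.ket0 = preState P x t := by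
  simp [stateAt, preState, pre, Matrix.mulVec_mulVec]

/-- If `V v` vanishes on the control-`l` sector with raised flag of lab `l`, then `v` vanishes
on the control-`l` sector with the unraised flag. -/
theorem eq_zero_of_Vmat_mulVec_eq_zero {P : Protocol N T S A X} (hVm : P.unitaryVm)
    (x : ∀ l, X l) {v : Idx N T S A → ℂ} {l : Fin N} {r : ∀ i, A i} {f : Fin N → Fin (T + 1)}
    (h : ∀ s b, (P.Vmat x).mulVec v
      (s, l.succ, Function.update r l b, Function.update f l (f l + 1)) = 0) (s : S) :
    v (s, l.succ, r, f) = 0 := by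
  have h0 : (fun q : S × A l => v (q.1, l.succ, Function.update r l q.2, f)) = 0 := by
    refine eq_zero_of_unitary_mulVec_eq_zero (hVm l (x l)) ?_
    ext ⟨s, b⟩
    simpa [Vmat_mulVec_succ] using h s b
  simpa using congrFun h0 (s, r l)

open Fin.NatCast Fin.CommRing in
theorem stateAt_flag {P : Protocol N T S A X} (hVm : P.unitaryVm) (hU : P.unitaryU)
    {x : ∀ l, X l} (hflag : P.flagOK x) (l : Fin N) (d t : ℕ) (hdt : t + d = T)
    (s : S) (c : Fin (N + 1)) (r : ∀ i, A i) (f : Fin N → Fin (T + 1))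
    (hf : ∀ j : ℕ, j ≤ d → f l + (j : Fin (T + 1)) ≠ 1) :
    stateAt P x t (s, c, r, f) = 0 := by
  induction d generalizing t s c r f with
  | zero =>
    obtain rfl : t = T := by simpa using hdt
    by_contra hne
    have := hflag (s, c, r, f) hne l
    exact hf 0 le_rfl (by simpa using this)
  | succ d ih =>
    have hpost := ih (t + 1) (by omega)
    have hpre : ∀ s c, preState P x t (s, c, r, f) = 0 := by
      intro s c
      induction c using Fin.cases with
      | zero =>
        rw [← Vmat_mulVec_zero P x (preState P x t), ← stateAt_succ]
        exact hpost s 0 r f fun j hj => hf j (by omega)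
      | succ m =>
        refine eq_zero_of_Vmat_mulVec_eq_zero hVm x (fun s b => ?_) s
        rw [← stateAt_succ]
        refine hpost _ _ _ _ fun j hj => ?_
        by_cases hm : l = m
        · subst hm
          have := hf (j + 1) (by omega)
          push_cast at this
          rwa [Function.update_self, add_assoc, add_comm (1 : Fin (T + 1))]
        · rw [Function.update_of_ne hm]
          exact hf j (by omega)
    have h0 : (fun q : S × Fin (N + 1) => stateAt P x t (q.1, q.2, r, f)) = 0 := by
      refine eq_zero_of_unitary_mulVec_eq_zero (hU (t + 1) (by omega) (by omega)) ?_
      ext ⟨s, c⟩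
      rw [← extSC_mulVec_s6]
      exact hpre s c
    exact congrFun h0 (s, c)

open Fin.NatCast Fin.CommRing in
/-- Under the flag constraint a lab with raised flag is never activated again. -/
theorem preState_succ_eq_zero {P : Protocol N T S A X} (hVm : P.unitaryVm) (hU : P.unitaryU)
    {x : ∀ l, X l} (hflag : P.flagOK x) {t : ℕ} (ht : t < T) (l : Fin N)
    (s : S) (r : ∀ i, A i) (f : Fin N → Fin (T + 1)) (hf : f l = 1) :
    preState P x t (s, l.succ, r, f) = 0 := by
  refine eq_zero_of_Vmat_mulVec_eq_zero hVm x (fun s b => ?_) s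
  rw [← stateAt_succ]
  refine stateAt_flag hVm hU hflag l (T - (t + 1)) (t + 1) (by omega) _ _ _ _ fun j hj h => ?_
  rw [Function.update_self, hf, add_assoc, add_eq_left] at h
  have h' : ((1 + j : ℕ) : Fin (T + 1)) = 0 := by exact_mod_cast h
  rw [Fin.natCast_eq_zero] at h'
  have := Nat.le_of_dvd (by omega) h'
  omega

/-- Weight of the state after step `t` on results `a` with all flags raised once. -/
def doneWeight (P : Protocol N T S A X) (x : ∀ l, X l) (a : ∀ i, A i) (t : ℕ) : ℝ :=
  ∑ q : S × Fin (N + 1), Complex.normSq (stateAt P x t (q.1, q.2, a, fun _ => 1))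

theorem doneWeight_zero (P : Protocol N T S A X) (x : ∀ l, X l) (a : ∀ i, A i)
    (hN : 1 ≤ N) (hT : 1 ≤ T) : doneWeight P x a 0 = 0 := by
  have h10 : (1 : Fin (T + 1)) ≠ 0 := by
    obtain ⟨T, rfl⟩ := Nat.exists_eq_add_of_le' hT
    exact one_ne_zero
  refine Finset.sum_eq_zero fun q _ => ?_
  rw [map_eq_zero]
  simp only [stateAt, chain, Matrix.one_mulVec, ket0]
  refine if_neg fun h => h10 ?_
  simp only [Prod.mk.injEq] at h
  exact congrFun h.2.2.2 ⟨0, hN⟩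

theorem doneWeight_final {P : Protocol N T S A X} {x : ∀ l, X l} (hflag : P.flagOK x)
    (a : ∀ i, A i) : doneWeight P x a T = P.pQ x a := by
  rw [doneWeight, ← nsq_ite_eq, pQ]
  congr 1
  ext ⟨s, c, r, f⟩
  change (if (r, f) = (a, fun _ => 1) then (P.Uop x).mulVec P.ket0 (s, c, r, f) else 0) =
    if r = a then (P.Uop x).mulVec P.ket0 (s, c, r, f) else 0
  by_cases h : (P.Uop x).mulVec P.ket0 (s, c, r, f) = 0
  · simp [h]
  · have hf : f = fun _ => 1 := funext (hflag _ h)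
    simp [hf]

theorem doneWeight_eq_sum_preState {P : Protocol N T S A X} (hVm : P.unitaryVm)
    (hU : P.unitaryU) {x : ∀ l, X l} (hflag : P.flagOK x) (a : ∀ i, A i) {t : ℕ} (ht : t < T) :
    doneWeight P x a t =
      ∑ s : S, Complex.normSq (preState P x t (s, 0, a, fun _ => 1)) := by
  rw [doneWeight, ← sum_normSq_unitary_mulVec (hU (t + 1) (by omega) (by omega)),
    Fintype.sum_prod_type]
  refine Finset.sum_congr rfl fun s _ => ?_
  simp only [← extSC_mulVec_s6, ← preState.eq_1]
  rw [Fin.sum_univ_succ, Finset.sum_eq_zero, add_zero]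
  intro l _
  rw [preState_succ_eq_zero hVm hU hflag ht l s a _ rfl, map_zero]

variable [∀ i, Fintype (X i)] [∀ i, DecidableEq (X i)]

/-- The just-measured state of lab `l` completing a full history is the part of the global
state with control `l`, results `a` and all flags raised. -/
theorem phiFull_apply (P : Protocol N T S A X) (x : ∀ l, X l) {H : Hist N A X}
    (hH : labsDistinct H) {a : ∀ i, A i}
    (hfull : ∀ l : Fin N, (⟨l, (a l, x l)⟩ : (i : Fin N) × (A i × X i)) ∈ H)
    (l : Fin N) (t : ℕ) (p : Idx N T S A) :
    P.phiFull x l (a l) (t + 1) H p =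
      if p.2.2 = (a, fun _ => 1) then
        (if p.2.1 = l.succ then stateAt P x (t + 1) p else 0) else 0 := by
  obtain ⟨s, c, r, f⟩ := p
  simp only [phiFull, phiOf]
  induction c using Fin.cases with
  | zero =>
    rw [Vmat_mulVec_zero]
    simp [psi, (Fin.succ_ne_zero l).symm]
  | succ m =>
    rw [Vmat_mulVec_succ, stateAt_succ, Vmat_mulVec_succ]
    by_cases hm : m = l
    · subst hm
      by_cases hrf : (r, f) = (a, fun _ => 1)
      · obtain ⟨rfl, rfl⟩ := Prod.mk.inj hrf
        rw [if_pos rfl, if_pos rfl, if_pos rfl]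
        congr 1
        ext q
        rw [psi, if_pos, pre_mulVec_ket0]
        refine ⟨rfl, (histSat_filter_ne hH hfull m _ _).2 ⟨fun i hi => ?_, ?_⟩⟩
        · simp [Function.update_of_ne hi]
        · simp
      · rw [if_neg hrf]
        refine ite_eq_right_iff.2 fun hr => ?_
        suffices h : (fun q : S × A m => P.psi x m.succ (t + 1)
            (H.filter fun e => decide (e.1 ≠ m)) (q.1, m.succ, Function.update r m q.2,
              Function.update f m (f m - 1))) = 0 by
          rw [h, Matrix.mulVec_zero, Pi.zero_apply]
        ext q
        refine if_neg fun h => hrf ?_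
        obtain ⟨h₁, h₂⟩ := (histSat_filter_ne hH hfull m _ _).1 h.2
        replace h₂ : f m = 1 := by simpa [sub_eq_zero] using h₂
        have h₃ : ∀ i, r i = a i ∧ f i = 1 := by
          intro i
          by_cases hi : i = m
          · subst hi
            exact ⟨hr, h₂⟩
          · simpa [Function.update_of_ne hi] using h₁ i hi
        exact Prod.ext (funext fun i => (h₃ i).1) (funext fun i => (h₃ i).2)
    · have h : (fun q : S × A m => P.psi x l.succ (t + 1)
            (H.filter fun e => decide (e.1 ≠ l)) (q.1, m.succ, Function.update r m q.2,
              Function.update f m (f m - 1))) = 0 := by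
        ext q
        simp [psi, hm]
      rw [h, Matrix.mulVec_zero, Pi.zero_apply]
      simp [hm]

theorem nsq_phiFull (P : Protocol N T S A X) (x : ∀ l, X l) {H : Hist N A X}
    (hH : labsDistinct H) {a : ∀ i, A i}
    (hfull : ∀ l : Fin N, (⟨l, (a l, x l)⟩ : (i : Fin N) × (A i × X i)) ∈ H)
    (l : Fin N) (t : ℕ) :
    nsq (P.phiFull x l (a l) (t + 1) H) =
      ∑ s : S, Complex.normSq (stateAt P x (t + 1) (s, l.succ, a, fun _ => 1)) := by
  rw [funext (phiFull_apply P x hH hfull l t), nsq_ite_eq, Fintype.sum_prod_type]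
  refine Finset.sum_congr rfl fun s _ => ?_
  rw [Finset.sum_eq_single l.succ]
  · simp
  · intro c _ hc
    simp [hc]
  · simp

theorem doneWeight_succ {P : Protocol N T S A X} (hVm : P.unitaryVm)
    (hU : P.unitaryU) {x : ∀ l, X l} (hflag : P.flagOK x) {H : Hist N A X}
    (hH : labsDistinct H) {a : ∀ i, A i}
    (hfull : ∀ l : Fin N, (⟨l, (a l, x l)⟩ : (i : Fin N) × (A i × X i)) ∈ H)
    {t : ℕ} (ht : t < T) :
    doneWeight P x a (t + 1) =
      doneWeight P x a t + ∑ l : Fin N, nsq (P.phiFull x l (a l) (t + 1) H) := by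
  simp only [doneWeight_eq_sum_preState hVm hU hflag a ht, nsq_phiFull P x hH hfull]
  rw [doneWeight, Fintype.sum_prod_type_right, Fin.sum_univ_succ]
  simp only [stateAt_succ, Vmat_mulVec_zero]

end CIQ

/-- **Result 3**: under the flag constraint, for a complete history `H_N`
containing all `N` labs with outcomes `a⃗` and the fixed settings `x⃗`,
`Σ_(l_N ∈ ℒ_N) Σ_(t_N=1)^T ‖φ_(l_N,t_N,H_N)‖² = ‖(|a⃗⟩⟨a⃗|_r ⊗ I) 𝒰 |0⟩‖²
  = p^quantum(a⃗|x⃗)`. -/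
theorem result_three
    (N T : ℕ) (S : Type) [Fintype S] [DecidableEq S]
    (A : Fin N → Type) [∀ i, Fintype (A i)] [∀ i, DecidableEq (A i)]
    (X : Fin N → Type) [∀ i, Fintype (X i)] [∀ i, DecidableEq (X i)]
    (hN : 1 ≤ N) (hT : N ≤ T)
    (P : Protocol N T S A X) (hVm : P.unitaryVm) (hU : P.unitaryU)
    (x : ∀ l, X l) (hflag : P.flagOK x)
    (H : Hist N A X) (hH : labsDistinct H) (a : ∀ i, A i)
    (hfull : ∀ l : Fin N, (⟨l, (a l, x l)⟩ : (i : Fin N) × (A i × X i)) ∈ H) :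
    ∑ l : Fin N, ∑ t ∈ Finset.Icc 1 T, nsq (P.phiFull x l (a l) t H) = P.pQ x a := by
  rw [Finset.sum_comm, ← doneWeight_final hflag a, ← Finset.Ico_add_one_right_eq_Icc,
    ← zero_add 1, ← add_assoc, ← Finset.sum_Ico_add', ← Finset.range_eq_Ico]
  rw [← sub_zero (doneWeight P x a T), ← doneWeight_zero P x a hN (hN.trans hT),
    ← Finset.sum_range_sub]
  refine Finset.sum_congr rfl fun t ht => ?_
  rw [doneWeight_succ hVm hU hflag hH hfull (Finset.mem_range.1 ht), add_sub_cancel_left]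
end
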